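/- Let Ω ⊂ ℝⁿ (n ≥ 2) be a bounded open set satisfying the interior measure density condition, let 1 < p < ∞, let 0 < β < 1, and let M > 0. There exist constants C > 0 and γ > 0, depending only on n, p, β, Ω, M, with the following property. Let σ₀, σ₁ : Ω → ℝ be measurable with 1/M ≤ σⱼ ≤ M a.e., and let A₀, A₁ : Ω → (n×n real matrices) be measurable with Aⱼ(x) symmetric and (1/M)|ξ|² ≤ Aⱼ(x)ξ·ξ ≤ M|ξ|² for a.e. x ∈ Ω and all ξ ∈ ℝⁿ. If u₀, u₁ ∈ C¹(closure Ω) are weak solutions of div(σⱼ|Aⱼ∇uⱼ·∇uⱼ|^{(p−2)/2}Aⱼ∇uⱼ) = 0 in Ω (j = 0, 1) with u₁ = u₀ on ∂Ω, whose gradients satisfy the Hölder bounds ‖∇uⱼ‖_{C^β(closure Ω)} ≤ M, then sup_{x ∈ Ω} |∇u₁(x) − ∇u₀(x)| ≤ C·(‖σ₁ − σ₀‖_{L^∞(Ω)} + ‖A₁ − A₀‖_{L^∞(Ω)})^γ. -/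

import Mathlib

open MeasureTheory Real
open scoped RealInnerProductSpace

/-- The linear action of an `n × n` real matrix on Euclidean space, as a
continuous linear map. -/
noncomputable def matCLM {n : ℕ} (M : Matrix (Fin n) (Fin n) ℝ) :
    EuclideanSpace ℝ (Fin n) →L[ℝ] EuclideanSpace ℝ (Fin n) :=
  LinearMap.toContinuousLinearMap (Matrix.toEuclideanLin M)

/-- `u` is a weak solution of `div(σ |A∇u·∇u|^((p-2)/2) A∇u) = 0` in `Ω`,
tested against `C¹(closure Ω)` functions vanishing on `∂Ω`. -/
def IsWeakSolution {n : ℕ} (Ω : Set (EuclideanSpace ℝ (Fin n))) (p : ℝ)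
    (σ : EuclideanSpace ℝ (Fin n) → ℝ)
    (A : EuclideanSpace ℝ (Fin n) → Matrix (Fin n) (Fin n) ℝ)
    (u : EuclideanSpace ℝ (Fin n) → ℝ) : Prop :=
  ∀ φ : EuclideanSpace ℝ (Fin n) → ℝ, ContDiffOn ℝ 1 φ (closure Ω) →
    (∀ x ∈ frontier Ω, φ x = 0) →
    ∫ x in Ω, σ x * |⟪matCLM (A x) (gradient u x), gradient u x⟫| ^ ((p - 2) / 2)
      * ⟪matCLM (A x) (gradient u x), gradient φ x⟫ = 0

/-- The `p`-Dirichlet energy `E_{σ,A}(v) = ∫_Ω σ |A∇v·∇v|^(p/2) dx`. -/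
noncomputable def energy {n : ℕ} (Ω : Set (EuclideanSpace ℝ (Fin n))) (p : ℝ)
    (σ : EuclideanSpace ℝ (Fin n) → ℝ)
    (A : EuclideanSpace ℝ (Fin n) → Matrix (Fin n) (Fin n) ℝ)
    (v : EuclideanSpace ℝ (Fin n) → ℝ) : ℝ :=
  ∫ x in Ω, σ x * |⟪matCLM (A x) (gradient v x), gradient v x⟫| ^ (p / 2)

/-- The `L^p(Ω)` norm of a vector field. -/
noncomputable def lpNormVF {n : ℕ} (Ω : Set (EuclideanSpace ℝ (Fin n))) (p : ℝ)
    (g : EuclideanSpace ℝ (Fin n) → EuclideanSpace ℝ (Fin n)) : ℝ :=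
  (∫ x in Ω, ‖g x‖ ^ p) ^ (1 / p)

/-- The `L^∞(Ω)` norm (essential supremum) of a scalar function. -/
noncomputable def linftyNorm {n : ℕ} (Ω : Set (EuclideanSpace ℝ (Fin n)))
    (f : EuclideanSpace ℝ (Fin n) → ℝ) : ℝ :=
  essSup (fun x => |f x|) (volume.restrict Ω)

/-- The `L^∞(Ω)` norm (essential supremum of the operator norm) of a
matrix-valued function. -/
noncomputable def linftyNormMat {n : ℕ} (Ω : Set (EuclideanSpace ℝ (Fin n)))
    (A : EuclideanSpace ℝ (Fin n) → Matrix (Fin n) (Fin n) ℝ) : ℝ :=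
  essSup (fun x => ‖matCLM (A x)‖) (volume.restrict Ω)

/-- `Ω` satisfies the interior measure density condition: there is `c > 0`
with `|B(x,r) ∩ Ω| ≥ c rⁿ` for all `x ∈ Ω` and `0 < r ≤ diam Ω`. -/
def MeasureDensityCondition {n : ℕ} (Ω : Set (EuclideanSpace ℝ (Fin n))) : Prop :=
  ∃ c : ℝ, 0 < c ∧ ∀ x ∈ Ω, ∀ r : ℝ, 0 < r → r ≤ Metric.diam Ω →
    ENNReal.ofReal (c * r ^ n) ≤ volume (Metric.ball x r ∩ Ω)


/-- The flux vector `σ |Tξ·ξ|^((p-2)/2) Tξ`. -/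
noncomputable def flux {E : Type*} [NormedAddCommGroup E] [InnerProductSpace ℝ E] (p σ : ℝ)
    (T : E →L[ℝ] E) (ξ : E) : E :=
  (σ * |⟪T ξ, ξ⟫| ^ ((p - 2) / 2)) • T ξ

/-- A symmetric operator whose quadratic form lies between `‖ξ‖² / M` and `M ‖ξ‖²`. -/
structure IsElliptic {E : Type*} [NormedAddCommGroup E] [InnerProductSpace ℝ E] (M : ℝ)
    (T : E →L[ℝ] E) : Prop where
  symm : ∀ ξ η, ⟪T ξ, η⟫ = ⟪ξ, T η⟫
  lower : ∀ ξ, 1 / M * ‖ξ‖ ^ 2 ≤ ⟪T ξ, ξ⟫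
  upper : ∀ ξ, ⟪T ξ, ξ⟫ ≤ M * ‖ξ‖ ^ 2

theorem monotone_scalar_of_two_le {p a b t : ℝ} (hp : 2 ≤ p) (ha : 0 ≤ a) (hb : 0 ≤ b)
    (ht : |t| ≤ a * b) :
    2⁻¹ * (2⁻¹ : ℝ) ^ (p - 2) * √(a ^ 2 + b ^ 2 - 2 * t) ^ p ≤
      a ^ (p - 2) * (a ^ 2 - t) + b ^ (p - 2) * (b ^ 2 - t) := by
  wlog hab : b ≤ a generalizing a b
  · have := this hb ha (by rwa [mul_comm]) (le_of_not_ge hab)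
    rw [add_comm (b ^ 2)] at this
    linarith
  obtain ⟨ht1, ht2⟩ := abs_le.1 ht
  set D := a ^ 2 + b ^ 2 - 2 * t with hD
  have hD0 : 0 ≤ D := by nlinarith [sq_nonneg (a - b)]
  have hDa : √D ≤ 2 * a := by
    apply Real.sqrt_le_iff.2 ⟨by positivity, by nlinarith⟩
  have hpow : b ^ (p - 2) ≤ a ^ (p - 2) := Real.rpow_le_rpow hb hab (by linarith)
  have hb0 : 0 ≤ b ^ (p - 2) := Real.rpow_nonneg hb _
  have hDp : √D ^ p = √D ^ (p - 2) * D := by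
    rcases (Real.sqrt_nonneg D).eq_or_lt with h | h
    · rw [← h, (Real.sqrt_eq_zero hD0).1 h.symm, Real.zero_rpow (by linarith), mul_zero]
    · nth_rewrite 3 [← Real.sq_sqrt hD0]
      rw [← Real.rpow_natCast √D 2, ← Real.rpow_add h]
      norm_num
  have hmain : (2⁻¹ : ℝ) ^ (p - 2) * √D ^ (p - 2) ≤ a ^ (p - 2) := by
    rw [← Real.mul_rpow (by norm_num) (Real.sqrt_nonneg D)]
    exact Real.rpow_le_rpow (by positivity) (by linarith) (by linarith)
  have h1 := mul_le_mul_of_nonneg_right hmain hD0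
  have h2 : 0 ≤ (a ^ (p - 2) - b ^ (p - 2)) * (a ^ 2 - b ^ 2) :=
    mul_nonneg (by linarith) (by nlinarith)
  have h3 := mul_nonneg hb0 hD0
  rw [hDp]
  nlinarith

theorem monotone_scalar_of_lt_two {p B a b t : ℝ} (hp1 : 1 < p) (hp : p < 2)
    (ha : 0 ≤ a) (hb : 0 ≤ b) (haB : a ≤ B) (hbB : b ≤ B) (ht : |t| ≤ a * b) :
    (p - 1) * B ^ (p - 2) * (a ^ 2 + b ^ 2 - 2 * t) ≤
      a ^ (p - 2) * (a ^ 2 - t) + b ^ (p - 2) * (b ^ 2 - t) := by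
  wlog hab : b ≤ a generalizing a b
  · have := this hb ha hbB haB (by rwa [mul_comm]) (le_of_not_ge hab)
    rw [add_comm (b ^ 2)] at this
    linarith
  obtain ⟨ht1, ht2⟩ := abs_le.1 ht
  rcases ha.eq_or_lt with rfl | ha
  · obtain rfl : b = 0 := le_antisymm hab hb
    obtain rfl : t = 0 := by nlinarith
    simp
  have hB : 0 < B := ha.trans_le haB
  have hBp : 0 < B ^ (p - 2) := Real.rpow_pos_of_pos hB _
  have haBp : B ^ (p - 2) ≤ a ^ (p - 2) :=
    Real.rpow_le_rpow_of_nonpos ha haB (by linarith)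
  set c := (p - 1) * B ^ (p - 2) with hc
  have hcB : c ≤ B ^ (p - 2) := by nlinarith
  rcases hb.eq_or_lt with rfl | hb
  · obtain rfl : t = 0 := by nlinarith
    nlinarith [sq_nonneg a]
  have hbBp : B ^ (p - 2) ≤ b ^ (p - 2) :=
    Real.rpow_le_rpow_of_nonpos hb hbB (by linarith)
  have ha1 : a ^ (p - 1) = a ^ (p - 2) * a := by
    rw [← Real.rpow_add_one ha.ne']; ring_nf
  have hb1 : b ^ (p - 1) = b ^ (p - 2) * b := by
    rw [← Real.rpow_add_one hb.ne']; ring_nf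
  have hbern : (b / a) ^ (p - 1) ≤ 1 + (p - 1) * (b / a - 1) := by
    have := rpow_one_add_le_one_add_mul_self (s := b / a - 1) (p := p - 1)
      (by have : 0 < b / a := by positivity
          linarith) (by linarith) (by linarith)
    simpa using this
  rw [Real.div_rpow hb.le ha.le, div_le_iff₀ (Real.rpow_pos_of_pos ha _)] at hbern
  have htan : b ^ (p - 2) * b ≤ a ^ (p - 2) * a + (p - 1) * a ^ (p - 2) * (b - a) := by
    rw [← hb1]
    refine hbern.trans_eq ?_
    rw [ha1]; field_simp
  have hca : c ≤ (p - 1) * a ^ (p - 2) := mul_le_mul_of_nonneg_left haBp (by linarith)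
  have h1 : c * (a - b) ≤ a ^ (p - 2) * a - b ^ (p - 2) * b := by
    nlinarith [mul_le_mul_of_nonneg_right hca (sub_nonneg.2 hab)]
  have h2 := mul_le_mul_of_nonneg_right h1 (sub_nonneg.2 hab)
  have h3 : 0 ≤ (a ^ (p - 2) + b ^ (p - 2) - 2 * c) * (a * b - t) :=
    mul_nonneg (by linarith) (by linarith)
  nlinarith

theorem exists_monotone_scalar {p : ℝ} (hp1 : 1 < p) {B : ℝ} (hB : 0 < B) :
    ∃ c, 0 < c ∧ ∀ a b t : ℝ, 0 ≤ a → 0 ≤ b → a ≤ B → b ≤ B → |t| ≤ a * b →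
      c * √(a ^ 2 + b ^ 2 - 2 * t) ^ max p 2 ≤
        a ^ (p - 2) * (a ^ 2 - t) + b ^ (p - 2) * (b ^ 2 - t) := by
  rcases le_or_gt 2 p with hp | hp
  · refine ⟨2⁻¹ * (2⁻¹ : ℝ) ^ (p - 2), by positivity, fun a b t ha hb _ _ ht => ?_⟩
    rw [max_eq_left hp]
    exact monotone_scalar_of_two_le hp ha hb ht
  · refine ⟨(p - 1) * B ^ (p - 2), mul_pos (by linarith) (Real.rpow_pos_of_pos hB _),
      fun a b t ha hb haB hbB ht => ?_⟩
    rw [max_eq_right hp.le, Real.rpow_two, Real.sq_sqrt]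
    · exact monotone_scalar_of_lt_two hp1 hp ha hb haB hbB ht
    · nlinarith [sq_nonneg (a - b), (abs_le.1 ht).2]

section Elliptic

variable {E : Type*} [NormedAddCommGroup E] [InnerProductSpace ℝ E] {M : ℝ} {T : E →L[ℝ] E}

theorem IsElliptic.inner_nonneg (hT : IsElliptic M T) (hM : 0 < M) (ξ : E) : 0 ≤ ⟪T ξ, ξ⟫ :=
  le_trans (by positivity) (hT.lower ξ)

theorem IsElliptic.inner_sq_le (hT : IsElliptic M T) (hM : 0 < M) (ξ η : E) :
    ⟪T ξ, η⟫ ^ 2 ≤ ⟪T ξ, ξ⟫ * ⟪T η, η⟫ := by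
  have h := discrim_le_zero (a := ⟪T η, η⟫) (b := 2 * ⟪T ξ, η⟫) (c := ⟪T ξ, ξ⟫) fun s => by
    have h := hT.inner_nonneg hM (ξ + s • η)
    have hs : ⟪T η, ξ⟫ = ⟪T ξ, η⟫ := by rw [hT.symm, real_inner_comm]
    simp only [map_add, map_smul, inner_add_left, inner_add_right, inner_smul_left,
      inner_smul_right, hs, RCLike.conj_to_real] at h
    nlinarith
  rw [discrim] at h
  nlinarith

theorem IsElliptic.norm_le (hT : IsElliptic M T) (hM : 0 < M) : ‖T‖ ≤ M := by
  refine T.opNorm_le_bound hM.le fun ξ => ?_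
  have h := hT.inner_sq_le hM ξ (T ξ)
  rw [real_inner_self_eq_norm_sq] at h
  have h2 := mul_le_mul (hT.upper ξ) (hT.upper (T ξ)) (hT.inner_nonneg hM _) (by positivity)
  rcases (norm_nonneg (T ξ)).eq_or_lt with h0 | h0
  · rw [← h0]; positivity
  refine le_of_sq_le_sq ?_ (by positivity)
  refine le_of_mul_le_mul_right ?_ (pow_pos h0 2)
  nlinarith

theorem flux_smul (p σ : ℝ) (T : E →L[ℝ] E) {r : ℝ} (hr : 0 < r) (ξ : E) :
    flux p σ T (r • ξ) = r ^ (p - 1) • flux p σ T ξ := by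
  have h : |r * (r * ⟪T ξ, ξ⟫)| ^ ((p - 2) / 2) * r =
      r ^ (p - 1) * |⟪T ξ, ξ⟫| ^ ((p - 2) / 2) := by
    rw [← mul_assoc, abs_mul, abs_of_pos (by positivity),
      Real.mul_rpow (by positivity) (abs_nonneg _), ← sq, ← Real.rpow_natCast r 2,
      ← Real.rpow_mul hr.le, mul_right_comm, ← Real.rpow_add_one hr.ne']
    congr 2; push_cast; ring
  simp only [flux, map_smul, inner_smul_left, inner_smul_right, RCLike.conj_to_real, smul_smul]
  congr 1
  linear_combination σ * h

theorem exists_rpow_bound_and_lipschitz (p : ℝ) (hM : 0 < M) :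
    ∃ L : ℝ, 0 ≤ L ∧ ∀ a ∈ Set.Icc (1 / M) M,
      |a ^ ((p - 2) / 2)| ≤ L ∧ ∀ b ∈ Set.Icc (1 / M) M,
        |a ^ ((p - 2) / 2) - b ^ ((p - 2) / 2)| ≤ L * |a - b| := by
  have hpos : ∀ a ∈ Set.Icc (1 / M) M, a ≠ 0 := fun a ha =>
    ((one_div_pos.2 hM).trans_le ha.1).ne'
  have hd : ContDiffOn ℝ 1 (fun a : ℝ => a ^ ((p - 2) / 2)) (Set.Icc (1 / M) M) := fun a ha =>
    (Real.contDiffAt_rpow_const_of_ne (hpos a ha)).contDiffWithinAt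
  obtain ⟨K, hK⟩ := hd.exists_lipschitzOnWith one_ne_zero (convex_Icc _ _) isCompact_Icc
  obtain ⟨C, hC⟩ := isCompact_Icc.exists_bound_of_continuousOn hd.continuousOn
  refine ⟨max C K, le_max_of_le_right K.2, fun a ha => ⟨(hC a ha).trans (le_max_left _ _),
    fun b hb => ?_⟩⟩
  have := hK.dist_le_mul a ha b hb
  rw [Real.dist_eq, Real.dist_eq] at this
  exact this.trans (mul_le_mul_of_nonneg_right (le_max_right _ _) (abs_nonneg _))

theorem exists_flux_bound_and_lipschitz {p : ℝ} (hp1 : 1 < p) (hM : 0 < M) :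
    ∃ K : ℝ, 0 < K ∧ ∀ (σ₀ σ₁ : ℝ) (T₀ T₁ : E →L[ℝ] E), |σ₀| ≤ M → |σ₁| ≤ M →
      IsElliptic M T₀ → IsElliptic M T₁ → ∀ ξ : E, ‖ξ‖ ≤ M →
        ‖flux p σ₀ T₀ ξ‖ ≤ K ∧
          ‖flux p σ₁ T₁ ξ - flux p σ₀ T₀ ξ‖ ≤ K * (|σ₁ - σ₀| + ‖T₁ - T₀‖) := by
  obtain ⟨L, hL0, hL⟩ := exists_rpow_bound_and_lipschitz p hM
  set K := L * M * M + L * M + M * L with hKdef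
  have hK0 : 0 ≤ K := by positivity
  have unit : ∀ (σ₀ σ₁ : ℝ) (T₀ T₁ : E →L[ℝ] E), |σ₀| ≤ M → |σ₁| ≤ M →
      IsElliptic M T₀ → IsElliptic M T₁ → ∀ ξ : E, ‖ξ‖ = 1 →
        ‖flux p σ₀ T₀ ξ‖ ≤ K ∧
          ‖flux p σ₁ T₁ ξ - flux p σ₀ T₀ ξ‖ ≤ K * (|σ₁ - σ₀| + ‖T₁ - T₀‖) := by
    intro σ₀ σ₁ T₀ T₁ h₀ h₁ hT₀ hT₁ ξ hξ
    have mem : ∀ T : E →L[ℝ] E, IsElliptic M T → ⟪T ξ, ξ⟫ ∈ Set.Icc (1 / M) M := fun T hT =>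
      ⟨by simpa [hξ] using hT.lower ξ, by simpa [hξ] using hT.upper ξ⟩
    have nT : ∀ T : E →L[ℝ] E, ‖T ξ‖ ≤ ‖T‖ := fun T => by simpa [hξ] using T.le_opNorm ξ
    have n₀ := (nT T₀).trans (hT₀.norm_le hM)
    have n₁ := (nT T₁).trans (hT₁.norm_le hM)
    have nd : ‖T₁ ξ - T₀ ξ‖ ≤ ‖T₁ - T₀‖ := nT (T₁ - T₀)
    obtain ⟨B₀, -⟩ := hL _ (mem T₀ hT₀)
    obtain ⟨B₁, B₂⟩ := hL _ (mem T₁ hT₁)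
    have hd : |⟪T₁ ξ, ξ⟫ - ⟪T₀ ξ, ξ⟫| ≤ ‖T₁ - T₀‖ := by
      rw [← inner_sub_left]
      refine (abs_real_inner_le_norm _ _).trans ?_
      rwa [hξ, mul_one]
    have B₃ := (B₂ _ (mem T₀ hT₀)).trans (mul_le_mul_of_nonneg_left hd hL0)
    simp only [flux, abs_of_nonneg (hT₀.inner_nonneg hM ξ), abs_of_nonneg (hT₁.inner_nonneg hM ξ)]
    generalize ⟪T₁ ξ, ξ⟫ ^ ((p - 2) / 2) = a₁ at *
    generalize ⟪T₀ ξ, ξ⟫ ^ ((p - 2) / 2) = a₀ at *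
    constructor
    · rw [norm_smul, norm_mul, Real.norm_eq_abs, Real.norm_eq_abs]
      calc |σ₀| * |a₀| * ‖T₀ ξ‖ ≤ M * L * M := by gcongr
        _ ≤ K := by rw [hKdef]; nlinarith [mul_nonneg hL0 hM.le]
    · have : (σ₁ * a₁) • T₁ ξ - (σ₀ * a₀) • T₀ ξ = ((σ₁ - σ₀) * a₁) • T₁ ξ +
          (σ₀ * (a₁ - a₀)) • T₁ ξ + (σ₀ * a₀) • (T₁ ξ - T₀ ξ) := by
        module
      rw [this]
      refine norm_add₃_le.trans ?_
      simp only [norm_smul, norm_mul, Real.norm_eq_abs]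
      calc |σ₁ - σ₀| * |a₁| * ‖T₁ ξ‖ + |σ₀| * |a₁ - a₀| * ‖T₁ ξ‖ + |σ₀| * |a₀| * ‖T₁ ξ - T₀ ξ‖
          ≤ |σ₁ - σ₀| * L * M + M * (L * ‖T₁ - T₀‖) * M + M * L * ‖T₁ - T₀‖ := by gcongr
        _ ≤ K * (|σ₁ - σ₀| + ‖T₁ - T₀‖) := by
          have h1 : 0 ≤ L * M * M * |σ₁ - σ₀| := by positivity
          have h2 : 0 ≤ M * L * |σ₁ - σ₀| := by positivity
          have h3 : 0 ≤ L * M * ‖T₁ - T₀‖ := by positivity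
          rw [hKdef]; nlinarith
  refine ⟨M ^ (p - 1) * K + 1, by positivity, fun σ₀ σ₁ T₀ T₁ h₀ h₁ hT₀ hT₁ ξ hξ => ?_⟩
  rcases eq_or_ne ξ 0 with rfl | hξ0
  · simp only [flux, map_zero, smul_zero, sub_zero, norm_zero]
    exact ⟨by positivity, by positivity⟩
  have hn : 0 < ‖ξ‖ := norm_pos_iff.2 hξ0
  obtain ⟨b₁, b₂⟩ := unit σ₀ σ₁ T₀ T₁ h₀ h₁ hT₀ hT₁ (‖ξ‖⁻¹ • ξ)
    (by rw [norm_smul, norm_inv, norm_norm, inv_mul_cancel₀ hn.ne'])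
  have hpow : ‖ξ‖ ^ (p - 1) ≤ M ^ (p - 1) := Real.rpow_le_rpow hn.le hξ (by linarith)
  have hpos : 0 ≤ ‖ξ‖ ^ (p - 1) := by positivity
  have hξe : ξ = ‖ξ‖ • (‖ξ‖⁻¹ • ξ) := by rw [smul_smul, mul_inv_cancel₀ hn.ne', one_smul]
  have hfl : ∀ σ T, flux p σ T ξ = ‖ξ‖ ^ (p - 1) • flux p σ T (‖ξ‖⁻¹ • ξ) := fun σ T => by
    conv_lhs => rw [hξe]
    exact flux_smul p σ T hn _
  rw [hfl σ₀ T₀, hfl σ₁ T₁, ← smul_sub, norm_smul, norm_smul, Real.norm_of_nonneg hpos]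
  have hd : 0 ≤ |σ₁ - σ₀| + ‖T₁ - T₀‖ := by positivity
  constructor
  · have := mul_le_mul hpow b₁ (norm_nonneg _) (by positivity)
    linarith
  · have := mul_le_mul hpow b₂ (norm_nonneg _) (by positivity)
    nlinarith

theorem exists_flux_monotone {p : ℝ} (hp1 : 1 < p) (hM : 0 < M) :
    ∃ c : ℝ, 0 < c ∧ ∀ (σ : ℝ) (T : E →L[ℝ] E), 1 / M ≤ σ → IsElliptic M T →
      ∀ ξ η : E, ‖ξ‖ ≤ M → ‖η‖ ≤ M →
        c * ‖ξ - η‖ ^ max p 2 ≤ ⟪flux p σ T ξ - flux p σ T η, ξ - η⟫ := by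
  obtain ⟨c, hc, h⟩ := exists_monotone_scalar hp1 (B := √(M * M ^ 2)) (by positivity)
  refine ⟨1 / M * (c * √(1 / M) ^ max p 2), by positivity, fun σ T hσ hT ξ η hξ hη => ?_⟩
  have root : ∀ ζ : E, |⟪T ζ, ζ⟫| ^ ((p - 2) / 2) = √⟪T ζ, ζ⟫ ^ (p - 2) := fun ζ => by
    rw [abs_of_nonneg (hT.inner_nonneg hM ζ), Real.sqrt_eq_rpow,
      ← Real.rpow_mul (hT.inner_nonneg hM ζ)]
    congr 1; ring
  have bd : ∀ ζ : E, ‖ζ‖ ≤ M → √⟪T ζ, ζ⟫ ≤ √(M * M ^ 2) := fun ζ hζ =>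
    Real.sqrt_le_sqrt ((hT.upper ζ).trans (by gcongr))
  have hs : ⟪T η, ξ⟫ = ⟪T ξ, η⟫ := by rw [hT.symm, real_inner_comm]
  have ht : |⟪T ξ, η⟫| ≤ √⟪T ξ, ξ⟫ * √⟪T η, η⟫ := by
    rw [← Real.sqrt_mul (hT.inner_nonneg hM ξ)]
    exact Real.abs_le_sqrt (hT.inner_sq_le hM ξ η)
  have key := h _ _ _ (Real.sqrt_nonneg _) (Real.sqrt_nonneg _) (bd ξ hξ) (bd η hη) ht
  rw [Real.sq_sqrt (hT.inner_nonneg hM ξ), Real.sq_sqrt (hT.inner_nonneg hM η)] at key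
  have hD : ⟪T ξ, ξ⟫ + ⟪T η, η⟫ - 2 * ⟪T ξ, η⟫ = ⟪T (ξ - η), ξ - η⟫ := by
    simp only [map_sub, inner_sub_left, inner_sub_right, hs]; ring
  have hval : ⟪flux p σ T ξ - flux p σ T η, ξ - η⟫ =
      σ * (√⟪T ξ, ξ⟫ ^ (p - 2) * (⟪T ξ, ξ⟫ - ⟪T ξ, η⟫) +
        √⟪T η, η⟫ ^ (p - 2) * (⟪T η, η⟫ - ⟪T ξ, η⟫)) := by
    simp only [flux, root, inner_sub_left, inner_sub_right, inner_smul_left, hs,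
      RCLike.conj_to_real]
    ring
  rw [hD] at key
  have hlow : √(1 / M) ^ max p 2 * ‖ξ - η‖ ^ max p 2 ≤ √⟪T (ξ - η), ξ - η⟫ ^ max p 2 := by
    rw [← Real.mul_rpow (Real.sqrt_nonneg _) (norm_nonneg _)]
    refine Real.rpow_le_rpow (by positivity) ?_ (le_max_of_le_right zero_le_two)
    refine Real.le_sqrt_of_sq_le ?_
    rw [mul_pow, Real.sq_sqrt (by positivity)]
    exact hT.lower _
  rw [hval]
  calc 1 / M * (c * √(1 / M) ^ max p 2) * ‖ξ - η‖ ^ max p 2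
      = 1 / M * (c * (√(1 / M) ^ max p 2 * ‖ξ - η‖ ^ max p 2)) := by ring
    _ ≤ 1 / M * (c * √⟪T (ξ - η), ξ - η⟫ ^ max p 2) := by gcongr
    _ ≤ 1 / M * _ := mul_le_mul_of_nonneg_left key (by positivity)
    _ ≤ σ * _ := mul_le_mul_of_nonneg_right hσ (le_trans (by positivity) key)

end Elliptic

section Matrix

variable {n : ℕ}

theorem inner_matCLM (A : Matrix (Fin n) (Fin n) ℝ) (v w : EuclideanSpace ℝ (Fin n)) :
    ⟪matCLM A v, w⟫ = ∑ i, ∑ j, A i j * v j * w i := by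
  simp only [matCLM, LinearMap.coe_toContinuousLinearMap', PiLp.inner_apply,
    Matrix.toEuclideanLin, Matrix.ofLp_toLpLin, Matrix.toLin'_apply, Matrix.mulVec, dotProduct, RCLike.inner_apply,
    RCLike.conj_to_real, Finset.mul_sum]
  exact Finset.sum_congr rfl fun i _ => Finset.sum_congr rfl fun j _ => by ring

theorem matCLM_sub (A B : Matrix (Fin n) (Fin n) ℝ) : matCLM (A - B) = matCLM A - matCLM B := by
  simp [matCLM]

theorem isElliptic_matCLM {M : ℝ} {A : Matrix (Fin n) (Fin n) ℝ} (hA : A.IsSymm)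
    (h : ∀ ξ : EuclideanSpace ℝ (Fin n),
      (1 / M) * ‖ξ‖ ^ 2 ≤ ⟪matCLM A ξ, ξ⟫ ∧ ⟪matCLM A ξ, ξ⟫ ≤ M * ‖ξ‖ ^ 2) :
    IsElliptic M (matCLM A) where
  symm ξ η := by
    rw [real_inner_comm, real_inner_comm, inner_matCLM, real_inner_comm, inner_matCLM,
      Finset.sum_comm]
    exact Finset.sum_congr rfl fun i _ => Finset.sum_congr rfl fun j _ => by
      rw [hA.apply]; ring
  lower ξ := (h ξ).1
  upper ξ := (h ξ).2

theorem aestronglyMeasurable_inner_flux {p : ℝ} {μ : Measure (EuclideanSpace ℝ (Fin n))}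
    {σ : EuclideanSpace ℝ (Fin n) → ℝ}
    {A : EuclideanSpace ℝ (Fin n) → Matrix (Fin n) (Fin n) ℝ}
    {g w : EuclideanSpace ℝ (Fin n) → EuclideanSpace ℝ (Fin n)}
    (hσ : Measurable σ) (hA : ∀ i j : Fin n, Measurable fun x => A x i j)
    (hg : AEMeasurable g μ) (hw : AEMeasurable w μ) :
    AEStronglyMeasurable (fun x => ⟪flux p (σ x) (matCLM (A x)) (g x), w x⟫) μ := by
  have coord : ∀ (v : EuclideanSpace ℝ (Fin n) → EuclideanSpace ℝ (Fin n)) (i : Fin n),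
      AEMeasurable v μ → AEMeasurable (fun x => v x i) μ := fun v i hv =>
    (EuclideanSpace.proj (𝕜 := ℝ) i).continuous.measurable.comp_aemeasurable hv
  have form : ∀ v : EuclideanSpace ℝ (Fin n) → EuclideanSpace ℝ (Fin n), AEMeasurable v μ →
      AEMeasurable (fun x => ⟪matCLM (A x) (g x), v x⟫) μ := fun v hv => by
    simp only [inner_matCLM]
    exact Finset.aemeasurable_fun_sum _ fun i _ => Finset.aemeasurable_fun_sum _ fun j _ =>
      ((hA i j).aemeasurable.mul (coord g j hg)).mul (coord v i hv)
  simp only [flux, inner_smul_left, RCLike.conj_to_real]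
  refine AEMeasurable.aestronglyMeasurable ?_
  refine (hσ.aemeasurable.mul ?_).mul (form w hw)
  exact (continuous_abs.measurable.comp_aemeasurable (form g hg)).pow_const _

end Matrix

/-- An `L^q` bound on a Hölder continuous vector field over a set with the measure density
condition controls its supremum by a power of that bound. -/
theorem exists_sup_bound_of_integral_rpow_le {n : ℕ} (hn : 0 < n)
    {Ω : Set (EuclideanSpace ℝ (Fin n))} (hΩopen : IsOpen Ω) (hΩbdd : Bornology.IsBounded Ω)
    (hΩdens : MeasureDensityCondition Ω) {q β N : ℝ} (hq : 0 < q) (hβ : 0 < β) (hN : 0 < N) :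
    ∃ C : ℝ, 0 < C ∧ ∃ γ : ℝ, 0 < γ ∧
      ∀ w : EuclideanSpace ℝ (Fin n) → EuclideanSpace ℝ (Fin n),
        IntegrableOn (fun x => ‖w x‖ ^ q) Ω → (∀ x ∈ Ω, ‖w x‖ ≤ N) →
        (∀ x ∈ Ω, ∀ y ∈ Ω, ‖w x - w y‖ ≤ N * ‖x - y‖ ^ β) →
        ∀ δ : ℝ, ∫ x in Ω, ‖w x‖ ^ q ≤ δ → ∀ x ∈ Ω, ‖w x‖ ≤ C * δ ^ γ := by
  rcases Ω.eq_empty_or_nonempty with rfl | hne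
  · exact ⟨1, one_pos, 1, one_pos, by simp⟩
  have : Nonempty (Fin n) := ⟨⟨0, hn⟩⟩
  obtain ⟨c, hc, hdens⟩ := hΩdens
  have hdiam : 0 < Metric.diam Ω := by
    refine Metric.diam_pos ?_ hΩbdd
    by_contra h
    exact (hΩopen.measure_pos volume hne).ne'
      ((Set.not_nontrivial_iff.1 h).measure_zero volume)
  set d := min 1 (Metric.diam Ω) with hd
  have hd0 : 0 < d := lt_min one_pos hdiam
  set k := c * d ^ n * (1 / (2 * N)) ^ (n / β : ℝ) * (1 / 2) ^ q with hk
  have hk0 : 0 < k := by positivity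
  set s := (n / β : ℝ) + q with hs
  have hs0 : 0 < s := by positivity
  refine ⟨(1 / k) ^ (1 / s), by positivity, 1 / s, by positivity,
    fun w hint hwN hhol δ hδ x hx => ?_⟩
  have hδ0 : 0 ≤ δ := le_trans (integral_nonneg fun y => by positivity) hδ
  rcases (norm_nonneg (w x)).eq_or_lt with hm | hm
  · rw [← hm]; positivity
  set m := ‖w x‖ with hmdef
  set r := d * (m / (2 * N)) ^ (1 / β) with hr
  have hr0 : 0 < r := by positivity
  have hmN : m / (2 * N) ≤ 1 := by
    rw [div_le_one (by positivity)]
    linarith [hwN x hx]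
  have hrd : r ≤ Metric.diam Ω :=
    (mul_le_of_le_one_right hd0.le (Real.rpow_le_one (by positivity) hmN (by positivity))).trans
      (min_le_right _ _)
  have hrβ : N * r ^ β ≤ m / 2 := by
    rw [hr, Real.mul_rpow hd0.le (by positivity), ← Real.rpow_mul (by positivity),
      one_div_mul_cancel hβ.ne', Real.rpow_one]
    have h1 : d ^ β ≤ 1 := Real.rpow_le_one hd0.le (min_le_left _ _) hβ.le
    calc N * (d ^ β * (m / (2 * N))) ≤ N * (1 * (m / (2 * N))) := by gcongr
      _ = m / 2 := by field_simp
  have hlow : ∀ y ∈ Metric.ball x r ∩ Ω, (m / 2) ^ q ≤ ‖w y‖ ^ q := by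
    rintro y ⟨hy, hyΩ⟩
    refine Real.rpow_le_rpow (by positivity) ?_ hq.le
    have h1 := hhol x hx y hyΩ
    have h2 : ‖x - y‖ ^ β ≤ r ^ β := by
      refine Real.rpow_le_rpow (norm_nonneg _) ?_ hβ.le
      rw [← dist_eq_norm, dist_comm]
      exact (Metric.mem_ball.1 hy).le
    have h3 := norm_sub_norm_le (w x) (w y)
    have h4 := mul_le_mul_of_nonneg_left h2 hN.le
    linarith
  have hfin : volume (Metric.ball x r ∩ Ω) ≠ ⊤ :=
    ((measure_mono Set.inter_subset_left).trans_lt measure_ball_lt_top).ne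
  have hvol : c * r ^ n ≤ volume.real (Metric.ball x r ∩ Ω) :=
    (ENNReal.ofReal_le_iff_le_toReal hfin).1 (hdens x hx r hr0 hrd)
  have hge : (m / 2) ^ q * volume.real (Metric.ball x r ∩ Ω) ≤ δ := by
    refine (setIntegral_ge_of_const_le_real (Metric.isOpen_ball.inter hΩopen).measurableSet hfin
      hlow (hint.mono_set Set.inter_subset_right)).trans (le_trans ?_ hδ)
    exact setIntegral_mono_set hint (ae_of_all _ fun y => by positivity)
      (Set.inter_subset_right.eventuallyLE)
  have hms : k * m ^ s ≤ δ := by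
    refine le_trans (le_of_eq ?_)
      ((mul_le_mul_of_nonneg_left hvol (by positivity : 0 ≤ (m / 2) ^ q)).trans hge)
    rw [hr, mul_pow, ← Real.rpow_natCast ((m / (2 * N)) ^ (1 / β)) n,
      ← Real.rpow_mul (by positivity), one_div_mul_eq_div, div_eq_mul_one_div m (2 * N),
      div_eq_mul_one_div m 2, Real.mul_rpow hm.le (by positivity),
      Real.mul_rpow hm.le (by positivity), hs, Real.rpow_add hm, hk]
    ring
  have hmδ : m ^ s ≤ 1 / k * δ := by
    rw [one_div_mul_eq_div, le_div_iff₀ hk0]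
    linarith
  rw [← Real.mul_rpow (by positivity) hδ0]
  calc m = (m ^ s) ^ (1 / s) := by
        rw [← Real.rpow_mul hm.le, mul_one_div_cancel hs0.ne', Real.rpow_one]
    _ ≤ (1 / k * δ) ^ (1 / s) := Real.rpow_le_rpow (by positivity) hmδ (by positivity)

/-- **Lemma 3.3**: stability of the gradient in `L^∞` under perturbation of the
coefficients, given uniform `C^β` bounds on the gradients of the solutions:
`‖∇u₁ − ∇u₀‖_{L^∞(Ω)} ≤ C (‖σ₁ − σ₀‖_∞ + ‖A₁ − A₀‖_∞)^γ`. -/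
theorem gradient_linfty_stability
    {n : ℕ} (hn : 2 ≤ n) (Ω : Set (EuclideanSpace ℝ (Fin n)))
    (hΩopen : IsOpen Ω) (hΩbdd : Bornology.IsBounded Ω)
    (hΩdens : MeasureDensityCondition Ω)
    (p : ℝ) (hp1 : 1 < p) (β : ℝ) (hβ0 : 0 < β) (hβ1 : β < 1)
    (M : ℝ) (hM : 0 < M) :
    ∃ C : ℝ, 0 < C ∧ ∃ γ : ℝ, 0 < γ ∧
      ∀ (σ₀ σ₁ : EuclideanSpace ℝ (Fin n) → ℝ)
        (A₀ A₁ : EuclideanSpace ℝ (Fin n) → Matrix (Fin n) (Fin n) ℝ),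
        Measurable σ₀ → Measurable σ₁ →
        (∀ i j : Fin n, Measurable fun x => A₀ x i j) →
        (∀ i j : Fin n, Measurable fun x => A₁ x i j) →
        (∀ᵐ x ∂(volume.restrict Ω), 1 / M ≤ σ₀ x ∧ σ₀ x ≤ M) →
        (∀ᵐ x ∂(volume.restrict Ω), 1 / M ≤ σ₁ x ∧ σ₁ x ≤ M) →
        (∀ᵐ x ∂(volume.restrict Ω), (A₀ x).IsSymm ∧
          ∀ ξ : EuclideanSpace ℝ (Fin n),
            (1 / M) * ‖ξ‖ ^ 2 ≤ ⟪matCLM (A₀ x) ξ, ξ⟫ ∧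
            ⟪matCLM (A₀ x) ξ, ξ⟫ ≤ M * ‖ξ‖ ^ 2) →
        (∀ᵐ x ∂(volume.restrict Ω), (A₁ x).IsSymm ∧
          ∀ ξ : EuclideanSpace ℝ (Fin n),
            (1 / M) * ‖ξ‖ ^ 2 ≤ ⟪matCLM (A₁ x) ξ, ξ⟫ ∧
            ⟪matCLM (A₁ x) ξ, ξ⟫ ≤ M * ‖ξ‖ ^ 2) →
        ∀ u₀ u₁ : EuclideanSpace ℝ (Fin n) → ℝ,
          ContDiffOn ℝ 1 u₀ (closure Ω) → ContDiffOn ℝ 1 u₁ (closure Ω) →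
          IsWeakSolution Ω p σ₀ A₀ u₀ → IsWeakSolution Ω p σ₁ A₁ u₁ →
          (∀ x ∈ frontier Ω, u₁ x = u₀ x) →
          -- uniform `C^β(closure Ω)` bounds on the gradients of the solutions
          (∀ x ∈ closure Ω, ‖gradient u₀ x‖ ≤ M) →
          (∀ x ∈ closure Ω, ‖gradient u₁ x‖ ≤ M) →
          (∀ x ∈ closure Ω, ∀ y ∈ closure Ω,
            ‖gradient u₀ x - gradient u₀ y‖ ≤ M * ‖x - y‖ ^ β) →
          (∀ x ∈ closure Ω, ∀ y ∈ closure Ω,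
            ‖gradient u₁ x - gradient u₁ y‖ ≤ M * ‖x - y‖ ^ β) →
          ∀ x ∈ Ω, ‖gradient u₁ x - gradient u₀ x‖ ≤
            C * (linftyNorm Ω (fun y => σ₁ y - σ₀ y)
                  + linftyNormMat Ω (fun y => A₁ y - A₀ y)) ^ γ := by
  obtain ⟨c, hc, hmono⟩ := exists_flux_monotone (E := EuclideanSpace ℝ (Fin n)) hp1 hM
  obtain ⟨K, hK, hflux⟩ := exists_flux_bound_and_lipschitz (E := EuclideanSpace ℝ (Fin n)) hp1 hM
  have hq : 0 < max p 2 := lt_max_of_lt_right two_pos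
  obtain ⟨C, hC, γ, hγ, hsup⟩ := exists_sup_bound_of_integral_rpow_le (by omega) hΩopen hΩbdd
    hΩdens hq hβ0 (N := 2 * M) (by positivity)
  set V := volume.real Ω with hV
  have hV0 : 0 ≤ V := measureReal_nonneg
  set R := K * (2 * M) * V / c with hR
  have hR0 : 0 ≤ R := by positivity
  refine ⟨C * (R + 1) ^ γ, by positivity, γ, hγ, ?_⟩
  intro σ₀ σ₁ A₀ A₁ hσ₀ hσ₁ hA₀ hA₁ bσ₀ bσ₁ eA₀ eA₁ u₀ u₁ hu₀ hu₁ hw₀ hw₁ hbd bg₀ bg₁ hg₀ hg₁ x hx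
  have hΩm := hΩopen.measurableSet
  have hΩfin : volume Ω ≠ ⊤ := hΩbdd.measure_lt_top.ne
  have : IsFiniteMeasure (volume.restrict Ω) := isFiniteMeasure_restrict.2 hΩfin
  have : (ae (volume.restrict Ω)).NeBot := by
    rw [ae_restrict_neBot]
    exact (hΩopen.measure_pos volume ⟨x, hx⟩).ne'
  set w : EuclideanSpace ℝ (Fin n) → EuclideanSpace ℝ (Fin n) :=
    fun y => gradient u₁ y - gradient u₀ y with hw
  have hcont : ∀ u : EuclideanSpace ℝ (Fin n) → ℝ, ContDiffOn ℝ 1 u (closure Ω) →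
      ContinuousOn (gradient u) Ω := fun u hu =>
    (InnerProductSpace.toDual ℝ (EuclideanSpace ℝ (Fin n))).symm.continuous.comp_continuousOn
      ((hu.mono subset_closure).continuousOn_fderiv_of_isOpen hΩopen le_rfl)
  have m₀ := (hcont _ hu₀).aemeasurable (μ := volume) hΩm
  have m₁ := (hcont _ hu₁).aemeasurable (μ := volume) hΩm
  have mw : AEMeasurable w (volume.restrict Ω) := m₁.sub m₀
  have hwbd : ∀ y ∈ Ω, ‖w y‖ ≤ 2 * M := fun y hy =>
    (norm_sub_le _ _).trans (by
      linarith [bg₀ y (subset_closure hy), bg₁ y (subset_closure hy)])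
  have hwhol : ∀ y ∈ Ω, ∀ z ∈ Ω, ‖w y - w z‖ ≤ 2 * M * ‖y - z‖ ^ β := fun y hy z hz => by
    have h0 := hg₀ y (subset_closure hy) z (subset_closure hz)
    have h1 := hg₁ y (subset_closure hy) z (subset_closure hz)
    have h2 := norm_sub_le (gradient u₁ y - gradient u₁ z) (gradient u₀ y - gradient u₀ z)
    rw [show w y - w z = gradient u₁ y - gradient u₁ z - (gradient u₀ y - gradient u₀ z) by
      simp only [hw]; abel]
    linarith
  have hgrad : ∀ y ∈ Ω, gradient (fun z => u₁ z - u₀ z) y = w y := fun y hy => by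
    have hd : ∀ u : EuclideanSpace ℝ (Fin n) → ℝ, ContDiffOn ℝ 1 u (closure Ω) →
        DifferentiableAt ℝ u y := fun u hu =>
      ((hu.mono subset_closure).differentiableOn one_ne_zero).differentiableAt (hΩopen.mem_nhds hy)
    simp only [hw, gradient, fderiv_fun_sub (hd u₁ hu₁) (hd u₀ hu₀), map_sub]
  have zero : ∀ (σ : EuclideanSpace ℝ (Fin n) → ℝ)
      (A : EuclideanSpace ℝ (Fin n) → Matrix (Fin n) (Fin n) ℝ) (u : EuclideanSpace ℝ (Fin n) → ℝ),
      IsWeakSolution Ω p σ A u →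
      ∫ y in Ω, ⟪flux p (σ y) (matCLM (A y)) (gradient u y), w y⟫ = 0 := fun σ A u h => by
    rw [← h (fun z => u₁ z - u₀ z) (hu₁.sub hu₀) fun y hy => by rw [hbd y hy, sub_self]]
    refine setIntegral_congr_fun hΩm fun y hy => ?_
    simp only [hgrad y hy, flux, inner_smul_left, RCLike.conj_to_real]
  have ell : ∀ A : EuclideanSpace ℝ (Fin n) → Matrix (Fin n) (Fin n) ℝ,
      (∀ᵐ x ∂(volume.restrict Ω), (A x).IsSymm ∧ ∀ ξ : EuclideanSpace ℝ (Fin n),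
        (1 / M) * ‖ξ‖ ^ 2 ≤ ⟪matCLM (A x) ξ, ξ⟫ ∧ ⟪matCLM (A x) ξ, ξ⟫ ≤ M * ‖ξ‖ ^ 2) →
      ∀ᵐ x ∂(volume.restrict Ω), IsElliptic M (matCLM (A x)) := fun A h =>
    h.mono fun y hy => isElliptic_matCLM hy.1 hy.2
  replace eA₀ := ell A₀ eA₀
  replace eA₁ := ell A₁ eA₁
  have habs : ∀ {s : ℝ}, 1 / M ≤ s ∧ s ≤ M → |s| ≤ M := fun {s} hs => by
    have := one_div_pos.2 hM
    rw [abs_of_nonneg (by linarith [hs.1])]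
    exact hs.2
  have integrable : ∀ (σ : EuclideanSpace ℝ (Fin n) → ℝ)
      (A : EuclideanSpace ℝ (Fin n) → Matrix (Fin n) (Fin n) ℝ)
      (g : EuclideanSpace ℝ (Fin n) → EuclideanSpace ℝ (Fin n)),
      Measurable σ → (∀ i j : Fin n, Measurable fun x => A x i j) →
      (∀ᵐ x ∂(volume.restrict Ω), 1 / M ≤ σ x ∧ σ x ≤ M) →
      (∀ᵐ x ∂(volume.restrict Ω), IsElliptic M (matCLM (A x))) →
      AEMeasurable g (volume.restrict Ω) → (∀ x ∈ closure Ω, ‖g x‖ ≤ M) →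
      IntegrableOn (fun y => ⟪flux p (σ y) (matCLM (A y)) (g y), w y⟫) Ω := by
    intro σ A g hσ hA bσ eA mg bg
    refine Integrable.of_bound (aestronglyMeasurable_inner_flux hσ hA mg mw) (K * (2 * M)) ?_
    filter_upwards [bσ, eA, ae_restrict_mem hΩm] with y h1 h2 hy
    refine (abs_real_inner_le_norm _ _).trans ?_
    exact mul_le_mul (hflux _ _ _ _ (habs h1) (habs h1) h2 h2 _ (bg y (subset_closure hy))).1
      (hwbd y hy) (norm_nonneg _) hK.le
  have i₀ := integrable σ₀ A₀ _ hσ₀ hA₀ bσ₀ eA₀ m₀ bg₀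
  have i₁ := integrable σ₁ A₁ _ hσ₁ hA₁ bσ₁ eA₁ m₁ bg₁
  have iw : IntegrableOn (fun y => ‖w y‖ ^ max p 2) Ω := by
    refine Integrable.of_bound (mw.norm.pow_const _).aestronglyMeasurable
      ((2 * M) ^ max p 2) ?_
    filter_upwards [ae_restrict_mem hΩm] with y hy
    rw [Real.norm_of_nonneg (by positivity)]
    exact Real.rpow_le_rpow (norm_nonneg _) (hwbd y hy) hq.le
  have hσsup : ∀ᵐ y ∂(volume.restrict Ω),
      |σ₁ y - σ₀ y| ≤ linftyNorm Ω (fun y => σ₁ y - σ₀ y) := by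
    refine ae_le_essSup (f := fun y => |σ₁ y - σ₀ y|) (Filter.isBoundedUnder_of_eventually_le
      (a := M + M) ?_)
    filter_upwards [bσ₀, bσ₁] with y h0 h1
    exact (abs_sub _ _).trans (add_le_add (habs h1) (habs h0))
  have hAsup : ∀ᵐ y ∂(volume.restrict Ω),
      ‖matCLM (A₁ y - A₀ y)‖ ≤ linftyNormMat Ω (fun y => A₁ y - A₀ y) := by
    refine ae_le_essSup (f := fun y => ‖matCLM (A₁ y - A₀ y)‖)
      (Filter.isBoundedUnder_of_eventually_le (a := M + M) ?_)
    filter_upwards [eA₀, eA₁] with y h0 h1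
    rw [matCLM_sub]
    exact (norm_sub_le _ _).trans (add_le_add (h1.norm_le hM) (h0.norm_le hM))
  set δ := linftyNorm Ω (fun y => σ₁ y - σ₀ y) + linftyNormMat Ω (fun y => A₁ y - A₀ y) with hδ
  have hδ0 : 0 ≤ δ := by
    obtain ⟨y, h1, h2⟩ := (hσsup.and hAsup).exists
    exact add_nonneg ((abs_nonneg _).trans h1) ((norm_nonneg _).trans h2)
  have hpt : ∀ᵐ y ∂(volume.restrict Ω), c * ‖w y‖ ^ max p 2 ≤
      ⟪flux p (σ₁ y) (matCLM (A₁ y)) (gradient u₁ y), w y⟫ -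
        ⟪flux p (σ₀ y) (matCLM (A₀ y)) (gradient u₀ y), w y⟫ + K * δ * (2 * M) := by
    filter_upwards [bσ₀, bσ₁, eA₀, eA₁, hσsup, hAsup, ae_restrict_mem hΩm] with
      y b0 b1 e0 e1 s1 s2 hy
    have hmon := hmono _ _ b1.1 e1 _ _ (bg₁ y (subset_closure hy)) (bg₀ y (subset_closure hy))
    have hlip := (hflux _ _ _ _ (habs b0) (habs b1) e0 e1 _ (bg₀ y (subset_closure hy))).2
    rw [matCLM_sub] at s2
    have hlip' := hlip.trans (mul_le_mul_of_nonneg_left (add_le_add s1 s2) hK.le)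
    have hin := (neg_le_abs _).trans ((abs_real_inner_le_norm
      (flux p (σ₁ y) (matCLM (A₁ y)) (gradient u₀ y) -
        flux p (σ₀ y) (matCLM (A₀ y)) (gradient u₀ y)) (w y)).trans
      (mul_le_mul hlip' (hwbd y hy) (norm_nonneg _) (by positivity)))
    change c * ‖w y‖ ^ max p 2 ≤ ⟪_, w y⟫ at hmon
    rw [inner_sub_left] at hmon hin
    linarith
  have henergy : ∫ y in Ω, ‖w y‖ ^ max p 2 ≤ R * δ := by
    have hsub : Integrable (fun y => ⟪flux p (σ₁ y) (matCLM (A₁ y)) (gradient u₁ y), w y⟫ -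
        ⟪flux p (σ₀ y) (matCLM (A₀ y)) (gradient u₀ y), w y⟫) (volume.restrict Ω) := i₁.sub i₀
    have h := integral_mono_ae (iw.const_mul c) (hsub.add (integrable_const _)) hpt
    have h2 : ∫ y in Ω, (⟪flux p (σ₁ y) (matCLM (A₁ y)) (gradient u₁ y), w y⟫ -
        ⟪flux p (σ₀ y) (matCLM (A₀ y)) (gradient u₀ y), w y⟫ + K * δ * (2 * M)) =
        V * (K * δ * (2 * M)) := by
      rw [integral_add hsub (integrable_const _), integral_sub i₁ i₀,
        zero _ _ _ hw₀, zero _ _ _ hw₁, setIntegral_const, smul_eq_mul]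
      ring
    have h3 : c * ∫ y in Ω, ‖w y‖ ^ max p 2 ≤ V * (K * δ * (2 * M)) := by
      rw [← h2, ← integral_const_mul]
      exact h
    rw [hR, div_mul_eq_mul_div, le_div_iff₀ hc]
    linarith
  refine (hsup w iw hwbd hwhol ((R + 1) * δ) (henergy.trans (by nlinarith)) x hx).trans_eq ?_
  rw [Real.mul_rpow (by positivity) hδ0, mul_assoc]
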